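/- Let D and G be directed multimetrics on the same set X with τ_D = τ_G. Then the topologies on K_F(X) generated by the families of pseudometrics D_{HF} = {d_{HF} : d ∈ D} and G_{HF} = {g_{HF} : g ∈ G} coincide: τ_{D_{HF}} = τ_{G_{HF}}. -/

import Mathlib

open Filter Topology Set

/-- A pseudometric on `X`. -/
def IsPseudometricFn {X : Type*} (d : X → X → ℝ) : Prop :=
  (∀ x y, 0 ≤ d x y) ∧ (∀ x, d x x = 0) ∧ (∀ x y, d x y = d y x) ∧
    ∀ x y z, d x y ≤ d x z + d z y

/-- The open ball of a pseudometric. -/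
def pball {X : Type*} (d : X → X → ℝ) (x : X) (ε : ℝ) : Set X := {y | d x y < ε}

/-- A multimetric: a family of pseudometrics separating points. -/
def IsMultimetric {X : Type*} (D : Set (X → X → ℝ)) : Prop :=
  (∀ d ∈ D, IsPseudometricFn d) ∧ ∀ x y : X, x ≠ y → ∃ d ∈ D, 0 < d x y

/-- A directed family of pseudometrics. -/
def IsDirectedMM {X : Type*} (D : Set (X → X → ℝ)) : Prop :=
  ∀ G : Finset (X → X → ℝ), ↑G ⊆ D → G.Nonempty →
    ∃ d ∈ D, ∀ g ∈ G, ∀ x y : X, g x y ≤ d x y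

/-- `U` is open in the topology `τ_D` generated by a family of pseudometrics `D`. -/
def IsTauOpen {X : Type*} (D : Set (X → X → ℝ)) (U : Set X) : Prop :=
  ∀ x ∈ U, ∃ ε > (0 : ℝ), ∃ G : Finset (X → X → ℝ), ↑G ⊆ D ∧ G.Nonempty ∧
    (⋂ d ∈ G, pball d x ε) ⊆ U

/-- `u` belongs to `K_F(X)`. -/
def IsFuzzyCompact {X : Type*} [TopologicalSpace X] (u : X → ℝ) : Prop :=
  (∀ x, u x ∈ Set.Icc (0 : ℝ) 1) ∧ (∃ x, u x = 1) ∧ UpperSemicontinuous u ∧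
    IsCompact (closure {x | 0 < u x})

open Classical in
/-- The `α`-cut of a fuzzy set. -/
noncomputable def acut {X : Type*} [TopologicalSpace X] (u : X → ℝ) (α : ℝ) : Set X :=
  if α = 0 then closure {x | 0 < u x} else {x | α ≤ u x}

/-- The Hausdorff pseudodistance associated to a pseudometric `d`. -/
noncomputable def hausPD {X : Type*} (d : X → X → ℝ) (K L : Set X) : ℝ :=
  max (sSup ((fun x => sInf ((fun y => d x y) '' L)) '' K))
      (sSup ((fun y => sInf ((fun x => d x y) '' K)) '' L))

/-- The fuzzy Hausdorff pseudodistance. -/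
noncomputable def dHF {X : Type*} [TopologicalSpace X] (d : X → X → ℝ) (u v : X → ℝ) : ℝ :=
  sSup ((fun α => hausPD d (acut u α) (acut v α)) '' Set.Icc (0 : ℝ) 1)

/-- The family `D_{HF}` of pseudometrics on `K_F(X)` induced by a family `D` of
pseudometrics on `X`. -/
noncomputable def DHF {X : Type*} [TopologicalSpace X] (D : Set (X → X → ℝ)) :
    Set ({u : X → ℝ // IsFuzzyCompact u} → {u : X → ℝ // IsFuzzyCompact u} → ℝ) :=
  (fun d => fun u v : {u : X → ℝ // IsFuzzyCompact u} => dHF d u.1 v.1) '' D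

theorem aux_ball_nhds {X : Type*} [TopologicalSpace X] {D : Set (X → X → ℝ)}
    (hDm : IsMultimetric D) (htop : ∀ U : Set X, IsOpen U ↔ IsTauOpen D U)
    {d : X → X → ℝ} (hd : d ∈ D) (x : X) {ε : ℝ} (hε : 0 < ε) : pball d x ε ∈ 𝓝 x := by
  obtain ⟨h0, h1, h2, h3⟩ := hDm.1 d hd
  refine IsOpen.mem_nhds ((htop _).2 ?_) (by simp [pball, h1, hε])
  intro y hy
  simp only [pball, mem_ofPred_eq] at hy
  refine ⟨ε - d x y, by linarith, {d}, by simpa using hd, by simp, ?_⟩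
  intro z hz
  simp only [Finset.mem_singleton, iInter_iInter_eq_left, pball, mem_ofPred_eq] at hz ⊢
  linarith [h3 x z y]

theorem aux_nonempty {X : Type*} [TopologicalSpace X] {D : Set (X → X → ℝ)}
    (htop : ∀ U : Set X, IsOpen U ↔ IsTauOpen D U) (x : X) : ∃ d, d ∈ D := by
  obtain ⟨_, _, F, hF, ⟨d, hd⟩, _⟩ := (htop univ).1 isOpen_univ x (mem_univ _)
  exact ⟨d, hF hd⟩

theorem aux_dir {X : Type*} {D : Set (X → X → ℝ)} (hDd : IsDirectedMM D)
    {a b : X → X → ℝ} (ha : a ∈ D) (hb : b ∈ D) :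
    ∃ d ∈ D, ∀ x y, a x y ≤ d x y ∧ b x y ≤ d x y := by
  classical
  obtain ⟨d, hd, h⟩ := hDd {a, b} (by
    intro z hz
    simp only [Finset.coe_insert, Finset.coe_singleton, mem_insert_iff, mem_singleton_iff] at hz
    rcases hz with rfl | rfl <;> assumption) (by simp)
  exact ⟨d, hd, fun x y => ⟨h a (by simp) x y, h b (by simp) x y⟩⟩

theorem aux_bdd {X : Type*} [TopologicalSpace X] {D : Set (X → X → ℝ)}
    (hDm : IsMultimetric D) (htop : ∀ U : Set X, IsOpen U ↔ IsTauOpen D U)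
    {d : X → X → ℝ} (hd : d ∈ D) (x₀ : X) {K : Set X} (hK : IsCompact K) :
    ∃ C, ∀ y ∈ K, d x₀ y ≤ C := by
  obtain ⟨h0, h1, h2, h3⟩ := hDm.1 d hd
  refine hK.induction_on (p := fun s => ∃ C, ∀ y ∈ s, d x₀ y ≤ C) ⟨0, by simp⟩ ?_ ?_ ?_
  · rintro s t hst ⟨C, hC⟩
    exact ⟨C, fun y hy => hC y (hst hy)⟩
  · rintro s t ⟨C, hC⟩ ⟨C', hC'⟩
    refine ⟨max C C', ?_⟩
    rintro y (hy | hy)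
    · exact (hC y hy).trans (le_max_left _ _)
    · exact (hC' y hy).trans (le_max_right _ _)
  · intro x _
    refine ⟨_, mem_nhdsWithin_of_mem_nhds (aux_ball_nhds hDm htop hd x one_pos), d x₀ x + 1, ?_⟩
    intro y hy
    simp only [pball, mem_ofPred_eq] at hy
    linarith [h3 x₀ y x]

theorem aux_unif {X : Type*} [TopologicalSpace X] {D G : Set (X → X → ℝ)}
    (hDm : IsMultimetric D) (hGm : IsMultimetric G) (hDd : IsDirectedMM D)
    (htopD : ∀ U : Set X, IsOpen U ↔ IsTauOpen D U)
    (htopG : ∀ U : Set X, IsOpen U ↔ IsTauOpen G U)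
    {g : X → X → ℝ} (hg : g ∈ G) (x₀ : X) {K : Set X} (hK : IsCompact K)
    {ε : ℝ} (hε : 0 < ε) :
    ∃ d ∈ D, ∃ δ > 0, ∀ x ∈ K, ∀ y, d x y < δ → g x y < ε := by
  obtain ⟨h0, h1, h2, h3⟩ := hGm.1 g hg
  refine hK.induction_on
    (p := fun s => ∃ d ∈ D, ∃ δ > 0, ∀ x ∈ s, ∀ y, d x y < δ → g x y < ε) ?_ ?_ ?_ ?_
  · obtain ⟨d, hd⟩ := aux_nonempty htopD x₀
    exact ⟨d, hd, 1, one_pos, by simp⟩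
  · rintro s t hst ⟨d, hd, δ, hδ, h⟩
    exact ⟨d, hd, δ, hδ, fun x hx => h x (hst hx)⟩
  · rintro s t ⟨a, ha, δ, hδ, h⟩ ⟨b, hb, δ', hδ', h'⟩
    obtain ⟨d, hd, hab⟩ := aux_dir hDd ha hb
    refine ⟨d, hd, min δ δ', lt_min hδ hδ', ?_⟩
    rintro x (hx | hx) y hy
    · exact h x hx y ((hab x y).1.trans_lt (hy.trans_le (min_le_left _ _)))
    · exact h' x hx y ((hab x y).2.trans_lt (hy.trans_le (min_le_right _ _)))
  · intro x _
    have hn := aux_ball_nhds hGm htopG hg x (half_pos hε)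
    obtain ⟨V, hV, hVo, hxV⟩ := mem_nhds_iff.1 hn
    obtain ⟨δ, hδ, F, hF, hFn, hFV⟩ := (htopD V).1 hVo x hxV
    obtain ⟨d, hd, hFd⟩ := hDd F hF hFn
    obtain ⟨k0, k1, k2, k3⟩ := hDm.1 d hd
    have key : ∀ y, d x y < δ → g x y < ε / 2 := fun y hy => by
      refine hV (hFV ?_)
      simp only [mem_iInter]
      exact fun f hf => (hFd f hf x y).trans_lt hy
    refine ⟨_, mem_nhdsWithin_of_mem_nhds (aux_ball_nhds hDm htopD hd x (half_pos hδ)),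
      d, hd, δ / 2, half_pos hδ, ?_⟩
    intro z hz y hy
    simp only [pball, mem_ofPred_eq] at hz
    have e1 := key z (by linarith)
    have e2 := key y (by linarith [k3 x y z])
    linarith [h3 z y x, h2 z x]

theorem aux_acut_sub {X : Type*} [TopologicalSpace X] (u : X → ℝ) {α : ℝ}
    (hα : α ∈ Icc (0 : ℝ) 1) : acut u α ⊆ closure {x | 0 < u x} := by
  unfold acut
  split_ifs with h
  · exact subset_rfl
  · intro x hx
    exact subset_closure ((lt_of_le_of_ne hα.1 (Ne.symm h)).trans_le hx)

theorem aux_acut_ne {X : Type*} [TopologicalSpace X] {u : X → ℝ} (hu : IsFuzzyCompact u) {α : ℝ}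
    (hα : α ∈ Icc (0 : ℝ) 1) : (acut u α).Nonempty := by
  obtain ⟨x, hx⟩ := hu.2.1
  refine ⟨x, ?_⟩
  unfold acut
  split_ifs with h
  · exact subset_closure (by simp [hx])
  · simp [hx, hα.2]

theorem aux_sInf_le {X : Type*} {f : X → ℝ} (hf : ∀ x, 0 ≤ f x) {L : Set X} {y : X}
    (hy : y ∈ L) {C : ℝ} (h : f y ≤ C) : sInf (f '' L) ≤ C :=
  (csInf_le ⟨0, by rintro _ ⟨z, _, rfl⟩; exact hf z⟩ (mem_image_of_mem f hy)).trans h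

theorem aux_main {X : Type*} [TopologicalSpace X] {D G : Set (X → X → ℝ)}
    (hDm : IsMultimetric D) (hGm : IsMultimetric G) (hDd : IsDirectedMM D)
    (htopD : ∀ U : Set X, IsOpen U ↔ IsTauOpen D U)
    (htopG : ∀ U : Set X, IsOpen U ↔ IsTauOpen G U)
    {g : X → X → ℝ} (hg : g ∈ G) {u : X → ℝ} (hu : IsFuzzyCompact u) {ε : ℝ} (hε : 0 < ε) :
    ∃ d ∈ D, ∃ δ > 0, ∀ v, IsFuzzyCompact v → dHF d u v < δ → dHF g u v < ε := by
  obtain ⟨x₀, hx₀⟩ := hu.2.1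
  obtain ⟨d, hd, δ, hδ, key⟩ :=
    aux_unif hDm hGm hDd htopD htopG hg x₀ hu.2.2.2 (half_pos hε)
  refine ⟨d, hd, δ, hδ, fun v hv huv => ?_⟩
  obtain ⟨h0, h1, h2, h3⟩ := hGm.1 g hg
  obtain ⟨k0, k1, k2, k3⟩ := hDm.1 d hd
  obtain ⟨C, hC⟩ := aux_bdd hDm htopD hd x₀ (hu.2.2.2.union hv.2.2.2)
  have hB : ∀ x ∈ closure {x | 0 < u x}, ∀ y ∈ closure {x | 0 < v x}, d x y ≤ C + C := by
    intro x hx y hy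
    have e1 := hC x (Or.inl hx)
    have e2 := hC y (Or.inr hy)
    linarith [k3 x y x₀, k2 x x₀]
  have hC0 : 0 ≤ C + C := by
    have := hC x₀ (Or.inl (subset_closure (by simp [hx₀])))
    linarith [k0 x₀ x₀]
  have b1 : ∀ α ∈ Icc (0 : ℝ) 1, ∀ x ∈ acut u α,
      sInf ((fun y => d x y) '' acut v α) ≤ C + C := by
    intro α hα x hx
    obtain ⟨y, hy⟩ := aux_acut_ne hv hα
    exact aux_sInf_le (f := fun y => d x y) (k0 x) hy
      (hB x (aux_acut_sub u hα hx) y (aux_acut_sub v hα hy))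
  have b2 : ∀ α ∈ Icc (0 : ℝ) 1, ∀ y ∈ acut v α,
      sInf ((fun x => d x y) '' acut u α) ≤ C + C := by
    intro α hα y hy
    obtain ⟨x, hx⟩ := aux_acut_ne hu hα
    exact aux_sInf_le (f := fun x => d x y) (fun x => k0 x y) hx
      (hB x (aux_acut_sub u hα hx) y (aux_acut_sub v hα hy))
  have hα' : ∀ α ∈ Icc (0 : ℝ) 1, hausPD d (acut u α) (acut v α) < δ := by
    intro α hα
    refine lt_of_le_of_lt (le_csSup ⟨C + C, ?_⟩ (mem_image_of_mem (fun α => hausPD d (acut u α) (acut v α)) hα)) huv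
    rintro _ ⟨β, hβ, rfl⟩
    refine max_le (Real.sSup_le ?_ hC0) (Real.sSup_le ?_ hC0)
    · rintro _ ⟨x, hx, rfl⟩
      exact b1 β hβ x hx
    · rintro _ ⟨x, hx, rfl⟩
      exact b2 β hβ x hx
  refine lt_of_le_of_lt (Real.sSup_le ?_ (half_pos hε).le) (half_lt_self hε)
  rintro _ ⟨α, hα, rfl⟩
  have hlt := hα' α hα
  refine max_le (Real.sSup_le ?_ (half_pos hε).le) (Real.sSup_le ?_ (half_pos hε).le)
  · rintro _ ⟨x, hx, rfl⟩
    have hi : sInf ((fun y => d x y) '' acut v α) < δ := by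
      refine lt_of_le_of_lt ?_ ((le_max_left _ _).trans_lt hlt)
      refine le_csSup ⟨C + C, ?_⟩ (mem_image_of_mem (fun x => sInf ((fun y => d x y) '' acut v α)) hx)
      rintro _ ⟨z, hz, rfl⟩
      exact b1 α hα z hz
    obtain ⟨_, ⟨y, hy, rfl⟩, hyd⟩ := exists_lt_of_csInf_lt ((aux_acut_ne hv hα).image _) hi
    exact aux_sInf_le (f := fun y => g x y) (h0 x) hy (key x (aux_acut_sub u hα hx) y hyd).le
  · rintro _ ⟨y, hy, rfl⟩
    have hi : sInf ((fun x => d x y) '' acut u α) < δ := by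
      refine lt_of_le_of_lt ?_ ((le_max_right _ _).trans_lt hlt)
      refine le_csSup ⟨C + C, ?_⟩ (mem_image_of_mem (fun y => sInf ((fun x => d x y) '' acut u α)) hy)
      rintro _ ⟨z, hz, rfl⟩
      exact b2 α hα z hz
    obtain ⟨_, ⟨x, hx, rfl⟩, hyd⟩ := exists_lt_of_csInf_lt ((aux_acut_ne hu hα).image _) hi
    exact aux_sInf_le (f := fun x => g x y) (fun x => h0 x y) hx
      (key x (aux_acut_sub u hα hx) y hyd).le

theorem aux_dir_half {X : Type*} [TopologicalSpace X] {D G : Set (X → X → ℝ)}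
    (hDm : IsMultimetric D) (hGm : IsMultimetric G) (hDd : IsDirectedMM D)
    (htopD : ∀ U : Set X, IsOpen U ↔ IsTauOpen D U)
    (htopG : ∀ U : Set X, IsOpen U ↔ IsTauOpen G U)
    (U : Set {u : X → ℝ // IsFuzzyCompact u}) (hU : IsTauOpen (DHF G) U) :
    IsTauOpen (DHF D) U := by
  classical
  intro u hu
  obtain ⟨ε, hε, F, hF, -, hFU⟩ := hU u hu
  obtain ⟨x₀, -⟩ := u.2.2.1
  obtain ⟨d₀, hd₀⟩ := aux_nonempty htopD x₀
  have claim : ∀ F : Finset ({u : X → ℝ // IsFuzzyCompact u} → {u : X → ℝ // IsFuzzyCompact u} → ℝ),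
      ↑F ⊆ DHF G → ∃ δ > (0 : ℝ), ∃ H : Finset ({u : X → ℝ // IsFuzzyCompact u} →
        {u : X → ℝ // IsFuzzyCompact u} → ℝ), ↑H ⊆ DHF D ∧ H.Nonempty ∧
        ∀ v, (∀ h ∈ H, h u v < δ) → ∀ f ∈ F, f u v < ε := by
    intro F
    induction F using Finset.induction_on with
    | empty =>
      intro _
      refine ⟨1, one_pos, {fun u v => dHF d₀ u.1 v.1}, ?_, by simp, by simp⟩
      simpa using ⟨d₀, hd₀, rfl⟩
    | insert f F _ ih =>
      intro hF
      rw [Finset.coe_insert, insert_subset_iff] at hF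
      obtain ⟨δ, hδ, H, hH, hHn, hv⟩ := ih hF.2
      obtain ⟨g, hg, rfl⟩ := hF.1
      obtain ⟨d, hd, δ', hδ', hm⟩ := aux_main hDm hGm hDd htopD htopG hg u.2 hε
      refine ⟨min δ δ', lt_min hδ hδ', insert (fun u v => dHF d u.1 v.1) H, ?_, by simp, ?_⟩
      · rw [Finset.coe_insert, insert_subset_iff]
        exact ⟨⟨d, hd, rfl⟩, hH⟩
      · intro v hlt f hf
        rcases Finset.mem_insert.1 hf with rfl | hf
        · exact hm v.1 v.2 ((hlt _ (Finset.mem_insert_self _ _)).trans_le (min_le_right _ _))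
        · exact hv v (fun h hh =>
            (hlt h (Finset.mem_insert_of_mem hh)).trans_le (min_le_left _ _)) f hf
  obtain ⟨δ, hδ, H, hH, hHn, hv⟩ := claim F hF
  refine ⟨δ, hδ, H, hH, hHn, fun v hvH => hFU ?_⟩
  simp only [mem_iInter] at hvH ⊢
  exact hv v hvH

/-- If `D` and `G` are directed multimetrics on the same set with `τ_D = τ_G`, then the
topologies on `K_F(X)` generated by `D_{HF}` and `G_{HF}` coincide. -/
theorem tau_DHF_eq_tau_GHF {X : Type*} [TopologicalSpace X] (D G : Set (X → X → ℝ))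
    (hDm : IsMultimetric D) (hGm : IsMultimetric G)
    (hDd : IsDirectedMM D) (hGd : IsDirectedMM G)
    (htopD : ∀ U : Set X, IsOpen U ↔ IsTauOpen D U)
    (heq : ∀ U : Set X, IsTauOpen D U ↔ IsTauOpen G U) :
    ∀ U : Set {u : X → ℝ // IsFuzzyCompact u},
      IsTauOpen (DHF D) U ↔ IsTauOpen (DHF G) U := by
  have htopG : ∀ U : Set X, IsOpen U ↔ IsTauOpen G U := fun U => (htopD U).trans (heq U)
  exact fun U => ⟨aux_dir_half hGm hDm hGd htopG htopD U, aux_dir_half hDm hGm hDd htopD htopG U⟩
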